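/- arXiv:2103.01046 — 6 statements merged into one kernel-verified Lean document; each statement's English description precedes it below -/
import Mathlib

section
/- Unit resolution is sound and complete for propositional Horn formulas: a Horn formula F is unsatisfiable if and only if the empty clause can be derived from F by unit resolution. -/
attribute [local instance] Classical.propDecidable

namespace QHornProlog

/-- Propositional variables. -/
abbrev Var := ℕ
/-- A literal is a variable together with a polarity (`true` = positive). -/
abbrev Lit := Var × Bool
/-- A clause is a finite set of literals. -/
abbrev Clause := Finset Lit
/-- A CNF formula is a finite set of clauses. -/
abbrev CNF := Finset Clause
/-- A Boolean assignment to the variables. -/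
abbrev Assignment := Var → Bool

/-- An assignment makes a literal true. -/
def litSat (a : Assignment) (l : Lit) : Prop := a l.1 = l.2
/-- An assignment satisfies a clause if some literal of it is made true. -/
def clauseSat (a : Assignment) (C : Clause) : Prop := ∃ l ∈ C, litSat a l
/-- An assignment satisfies a CNF if it satisfies every clause. -/
def cnfSat (a : Assignment) (F : CNF) : Prop := ∀ C ∈ F, clauseSat a C
/-- A CNF formula is satisfiable if some assignment satisfies it. -/
def CnfSatisfiable (F : CNF) : Prop := ∃ a, cnfSat a F

/-- The positive literals of a clause. -/
def posLits (C : Clause) : Clause := C.filter (fun l => l.2 = true)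
/-- A Horn clause has at most one positive literal. -/
def IsHornClause (C : Clause) : Prop := (posLits C).card ≤ 1
/-- A definite Horn clause has exactly one positive literal. -/
def IsDefiniteClause (C : Clause) : Prop := (posLits C).card = 1
/-- A negative (goal) clause has only negative literals. -/
def IsNegativeClause (C : Clause) : Prop := ∀ l ∈ C, l.2 = false
/-- A Horn formula consists of Horn clauses. -/
def IsHornFormula (F : CNF) : Prop := ∀ C ∈ F, IsHornClause C

/-- `R` is the resolvent of `C` and `D` on pivot `x`. -/
def IsResolvent (C D R : Clause) (x : Var) : Prop :=
  (x, true) ∈ C ∧ (x, false) ∈ D ∧ R = C.erase (x, true) ∪ D.erase (x, false)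

/-- A unit resolution refutation of `F`: a sequence of clauses ending in the empty
clause, each either in `F` or a resolvent of two earlier clauses where at least one
premise is a unit clause. -/
def IsUnitResRefutation (F : CNF) (L : List Clause) : Prop :=
  L ≠ [] ∧ L.getLast? = some (∅ : Clause) ∧
  ∀ i (hi : i < L.length),
    L.get ⟨i, hi⟩ ∈ F ∨
    ∃ j k, ∃ (hj : j < i) (hk : k < i), ∃ x : Var,
      ((L.get ⟨j, hj.trans hi⟩).card = 1 ∨ (L.get ⟨k, hk.trans hi⟩).card = 1) ∧
      IsResolvent (L.get ⟨j, hj.trans hi⟩) (L.get ⟨k, hk.trans hi⟩) (L.get ⟨i, hi⟩) x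

/-- An SLD-resolution refutation of `F`: a sequence of negative clauses starting at a
goal clause of `F`, each next clause the resolvent of the previous (centre) clause with
a definite clause of `F` (side clause) on its head, ending in the empty clause. -/
def IsSLDRefutation (F : CNF) (L : List Clause) : Prop :=
  ∃ h : L ≠ [],
    L.head h ∈ F ∧ IsNegativeClause (L.head h) ∧ L.getLast h = (∅ : Clause) ∧
    ∀ i (hi : i + 1 < L.length),
      ∃ C ∈ F, ∃ x : Var,
        posLits C = {(x, true)} ∧ (x, false) ∈ L.get ⟨i, Nat.lt_of_succ_lt hi⟩ ∧
        L.get ⟨i + 1, hi⟩ =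
          (L.get ⟨i, Nat.lt_of_succ_lt hi⟩).erase (x, false) ∪ C.erase (x, true)

/-! ### Quantified Boolean formulas in closed prenex form -/

/-- A quantifier prefix: a list of blocks, each a quantifier (`true` = ∃, `false` = ∀)
together with a finite set of variables. -/
abbrev QPrefix := List (Bool × Finset Var)

/-- All variables occurring in the prefix. -/
def prefixVars (Pf : QPrefix) : Finset Var := Pf.foldr (fun p s => p.2 ∪ s) ∅
/-- Variables of a clause. -/
def clauseVars (C : Clause) : Finset Var := C.image Prod.fst
/-- Variables of a CNF. -/
def cnfVars (F : CNF) : Finset Var := F.sup clauseVars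

/-- Override an assignment on the set `X` by the assignment `b`. -/
def override (a : Assignment) (X : Finset Var) (b : Assignment) : Assignment :=
  fun v => if v ∈ X then b v else a v

/-- Recursive truth evaluation of a prenex QBF relative to an ambient assignment:
an ∃-block requires some assignment of its variables, a ∀-block requires all. -/
def QEval : QPrefix → CNF → Assignment → Prop
  | [], φ, a => cnfSat a φ
  | (true, X) :: Pf, φ, a => ∃ b, QEval Pf φ (override a X b)
  | (false, X) :: Pf, φ, a => ∀ b, QEval Pf φ (override a X b)

/-- Truth of a closed prenex QBF. -/
def QTrue (Pf : QPrefix) (φ : CNF) : Prop := QEval Pf φ (fun _ => false)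

/-- `Pf.φ` is a closed prenex QBF: the blocks are pairwise disjoint and every variable
of the matrix is quantified. -/
def ClosedQBF (Pf : QPrefix) (φ : CNF) : Prop :=
  Pf.Pairwise (fun p q => Disjoint p.2 q.2) ∧ cnfVars φ ⊆ prefixVars Pf

/-- A variable is existential if it lies in an ∃-block. -/
def IsExistential (Pf : QPrefix) (v : Var) : Prop := ∃ p ∈ Pf, p.1 = true ∧ v ∈ p.2
/-- A variable is universal if it lies in a ∀-block. -/
def IsUniversal (Pf : QPrefix) (v : Var) : Prop := ∃ p ∈ Pf, p.1 = false ∧ v ∈ p.2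
/-- A quantified Horn formula: a closed prenex QBF with a Horn matrix. -/
def IsQHorn (Pf : QPrefix) (φ : CNF) : Prop := ClosedQBF Pf φ ∧ IsHornFormula φ

/-- Variable `v` lies in block number `i` (0-indexed) of the prefix. -/
def hasLevel (Pf : QPrefix) (v : Var) (i : ℕ) : Prop :=
  ∃ h : i < Pf.length, v ∈ (Pf.get ⟨i, h⟩).2
/-- Variable `v` is at or to the left of variable `w` in the prefix ordering. -/
def levelLE (Pf : QPrefix) (v w : Var) : Prop :=
  ∃ i j, i ≤ j ∧ hasLevel Pf v i ∧ hasLevel Pf w j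

/-- Clauses of the matrix with exactly one positive literal, which is existential. -/
noncomputable def Fexist (Pf : QPrefix) (φ : CNF) : CNF :=
  φ.filter (fun C => ∃ x, posLits C = {(x, true)} ∧ IsExistential Pf x)
/-- Clauses of the matrix with exactly one positive literal, which is universal. -/
noncomputable def Fforall (Pf : QPrefix) (φ : CNF) : CNF :=
  φ.filter (fun C => ∃ x, posLits C = {(x, true)} ∧ IsUniversal Pf x)
/-- Goal clauses: clauses with only negative literals. -/
noncomputable def Fgoal (φ : CNF) : CNF := φ.filter IsNegativeClause

/-- One SLD-Q-resolution step from centre clause `N` to `N'`: either resolution with a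
definite clause of `φ` on its existential head, or universal reduction of a universal
literal not blocked by any existential literal at or to its right. -/
def SLDQStep (Pf : QPrefix) (φ : CNF) (N N' : Clause) : Prop :=
  (∃ C ∈ φ, ∃ x : Var, posLits C = {(x, true)} ∧ IsExistential Pf x ∧
     (x, false) ∈ N ∧ N' = N.erase (x, false) ∪ C.erase (x, true)) ∨
  (∃ l ∈ N, IsUniversal Pf l.1 ∧
     (∀ k ∈ N, IsExistential Pf k.1 → ¬ levelLE Pf l.1 k.1) ∧
     N' = N.erase l)

/-- An SLD-Q-resolution refutation of `Pf.φ`: a sequence of negative clauses starting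
at a goal clause of `φ`, proceeding by SLD-Q-resolution steps, ending in the empty
clause. -/
def IsSLDQRefutation (Pf : QPrefix) (φ : CNF) (L : List Clause) : Prop :=
  ∃ h : L ≠ [],
    L.head h ∈ φ ∧ IsNegativeClause (L.head h) ∧ L.getLast h = (∅ : Clause) ∧
    ∀ i (hi : i + 1 < L.length),
      SLDQStep Pf φ (L.get ⟨i, Nat.lt_of_succ_lt hi⟩) (L.get ⟨i + 1, hi⟩)

/-! ### Skolem-function models and logical equivalence -/

/-- A family of candidate Skolem functions: to every variable a function from
assignments to Booleans. -/
abbrev SkolemFamily := Var → Assignment → Bool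

/-- Variables of the first `i` blocks of the prefix. -/
def varsUpTo (Pf : QPrefix) (i : ℕ) : Finset Var := prefixVars (Pf.take i)

/-- Each Skolem function for an existential variable depends only on the variables
quantified to the left of it (i.e. in strictly earlier blocks). -/
def DependsOnlyOuter (Pf : QPrefix) (σ : SkolemFamily) : Prop :=
  ∀ i (hi : i < Pf.length), (Pf.get ⟨i, hi⟩).1 = true →
    ∀ v ∈ (Pf.get ⟨i, hi⟩).2, ∀ a b : Assignment,
      (∀ w ∈ varsUpTo Pf i, a w = b w) → σ v a = σ v b

/-- A complete assignment is consistent with the Skolem family if every existential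
variable takes the value prescribed by its Skolem function. -/
def ConsistentWith (Pf : QPrefix) (σ : SkolemFamily) (a : Assignment) : Prop :=
  ∀ v, IsExistential Pf v → a v = σ v a

/-- `σ` is a model of `Pf.φ`: its functions depend only on outer variables and every
consistent complete assignment satisfies the matrix. -/
def IsModel (Pf : QPrefix) (φ : CNF) (σ : SkolemFamily) : Prop :=
  DependsOnlyOuter Pf σ ∧ ∀ a : Assignment, ConsistentWith Pf σ a → cnfSat a φ

/-- Two QBFs with the same prefix are logically equivalent iff they have exactly the
same models. -/
def LogEquiv (Pf : QPrefix) (φ φ' : CNF) : Prop :=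
  ∀ σ : SkolemFamily, IsModel Pf φ σ ↔ IsModel Pf φ' σ

/-- The abstraction `Pf_i`: all variables of the first `i` blocks are made existential
and put in a single leading ∃-block. -/
def abstraction (Pf : QPrefix) (i : ℕ) : QPrefix :=
  (true, varsUpTo Pf i) :: Pf.drop i

/-- The complement of a literal. -/
def negLit (l : Lit) : Lit := (l.1, !l.2)

/-- `C̄`: the conjunction (CNF) of unit clauses `{¬ℓ}` for the literals `ℓ` of `C`. -/
def negUnits (C : Clause) : CNF := C.image (fun l => ({negLit l} : Clause))

/-- The outer clause `OC(Pf, D, m)`: literals of `D` other than `m` at or to the left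
of `m`. -/
noncomputable def outerClause (Pf : QPrefix) (D : Clause) (m : Lit) : Clause :=
  (D.erase m).filter (fun k => levelLE Pf k.1 m.1)

/-- The outer resolvent `OR(Pf, C, D, ℓ)`. -/
noncomputable def outerResolvent (Pf : QPrefix) (C D : Clause) (l : Lit) : Clause :=
  C.erase l ∪ outerClause Pf D (negLit l)

/-- Property QIOR⁺ of a clause `C` on literal `ℓ ∈ C` with respect to `Pf.ψ`. -/
def QIORplus (Pf : QPrefix) (ψ : CNF) (C : Clause) (l : Lit) : Prop :=
  l ∈ C ∧ ∀ D ∈ ψ, negLit l ∈ D → LogEquiv Pf ψ (insert (outerResolvent Pf C D l) ψ)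

/-- Restrict every block of a prefix to the variable set `V`. -/
def restrictPrefix (Pf : QPrefix) (V : Finset Var) : QPrefix :=
  Pf.map (fun p => (p.1, p.2 ∩ V))

/-- Normal form of a prefix: drop empty blocks and merge adjacent blocks carrying the
same quantifier. -/
def normalize : QPrefix → QPrefix
  | [] => []
  | p :: Pf =>
    let r := normalize Pf
    if p.2 = ∅ then r
    else
      match r with
      | [] => [p]
      | q :: r' => if p.1 = q.1 then (p.1, p.2 ∪ q.2) :: r' else p :: q :: r'

/-- `Pf'` extends `Pf` by the new variables `S`, placed arbitrarily in the prefix: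
the variables of `Pf'` are those of `Pf` together with `S`, and removing `S` from
`Pf'` gives back `Pf` (up to empty blocks and block splitting). -/
def PrefixExtends (Pf Pf' : QPrefix) (S : Finset Var) : Prop :=
  Disjoint (prefixVars Pf) S ∧
  prefixVars Pf' = prefixVars Pf ∪ S ∧
  normalize (restrictPrefix Pf' (prefixVars Pf)) = normalize Pf

/-- Renaming of a literal with respect to a set `S` of variables. -/
def renameLit (S : Finset Var) (l : Lit) : Lit := if l.1 ∈ S then negLit l else l
/-- Renaming of a clause. -/
def renameClause (S : Finset Var) (C : Clause) : Clause := C.image (renameLit S)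
/-- Renaming of a CNF matrix. -/
def renameCNF (S : Finset Var) (φ : CNF) : CNF := φ.image (renameClause S)


/-- The clauses derivable from `F` by unit resolution. -/
inductive UnitDerivable (F : CNF) : Clause → Prop
  | mem {C : Clause} (hC : C ∈ F) : UnitDerivable F C
  | resolve {C D R : Clause} {x : Var} (hC : UnitDerivable F C) (hD : UnitDerivable F D)
      (hunit : C.card = 1 ∨ D.card = 1) (hR : IsResolvent C D R x) : UnitDerivable F R

/-- A sequence of clauses, each in `F` or a unit resolvent of two earlier clauses. -/
def IsUnitResDerivation (F : CNF) (L : List Clause) : Prop :=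
  ∀ i (hi : i < L.length),
    L.get ⟨i, hi⟩ ∈ F ∨
    ∃ j k, ∃ (hj : j < i) (hk : k < i), ∃ x : Var,
      ((L.get ⟨j, hj.trans hi⟩).card = 1 ∨ (L.get ⟨k, hk.trans hi⟩).card = 1) ∧
      IsResolvent (L.get ⟨j, hj.trans hi⟩) (L.get ⟨k, hk.trans hi⟩) (L.get ⟨i, hi⟩) x

theorem IsUnitResDerivation.concat {F : CNF} {L : List Clause} {R : Clause}
    (hL : IsUnitResDerivation F L)
    (hR : R ∈ F ∨ ∃ C ∈ L, ∃ D ∈ L, ∃ x : Var,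
      (C.card = 1 ∨ D.card = 1) ∧ IsResolvent C D R x) :
    IsUnitResDerivation F (L ++ [R]) := by
  intro i hi
  have get_left (j : ℕ) (hj : j < L.length) (hj' : j < (L ++ [R]).length) :
      (L ++ [R]).get ⟨j, hj'⟩ = L.get ⟨j, hj⟩ := by
    simp [List.getElem_append_left hj]
  rcases Nat.lt_or_ge i L.length with h | h
  · rcases hL i h with hF | ⟨j, k, hj, hk, x, hunit, hres⟩
    · exact Or.inl (by rwa [get_left i h])
    · refine Or.inr ⟨j, k, hj, hk, x, ?_⟩
      rw [get_left i h, get_left j (hj.trans h), get_left k (hk.trans h)]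
      exact ⟨hunit, hres⟩
  · obtain rfl : i = L.length := by
      simp only [List.length_append, List.length_singleton] at hi
      omega
    have get_last : (L ++ [R]).get ⟨L.length, hi⟩ = R := by simp
    rw [get_last]
    refine hR.imp_right ?_
    rintro ⟨C, hC, D, hD, x, hunit, hres⟩
    obtain ⟨⟨j, hj⟩, rfl⟩ := List.get_of_mem hC
    obtain ⟨⟨k, hk⟩, rfl⟩ := List.get_of_mem hD
    refine ⟨j, k, hj, hk, x, ?_⟩
    rw [get_left j hj, get_left k hk]
    exact ⟨hunit, hres⟩

/-- Every derivation extends to one that ends in a given derivable clause. -/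
theorem UnitDerivable.exists_extension {F : CNF} {C : Clause} (hC : UnitDerivable F C) :
    ∀ L, IsUnitResDerivation F L →
      ∃ L', IsUnitResDerivation F (L' ++ [C]) ∧ L ⊆ L' ++ [C] := by
  induction hC with
  | mem hC => exact fun L hL => ⟨L, hL.concat (Or.inl hC), List.subset_append_left _ _⟩
  | @resolve C D R x _ _ hunit hR ihC ihD =>
    intro L hL
    obtain ⟨L₁, h₁, hsub₁⟩ := ihC L hL
    obtain ⟨L₂, h₂, hsub₂⟩ := ihD _ h₁
    exact ⟨L₂ ++ [D],
      h₂.concat (Or.inr ⟨C, hsub₂ (by simp), D, by simp, x, hunit, hR⟩),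
      fun _ hE => List.subset_append_left _ _ (hsub₂ (hsub₁ hE))⟩

theorem UnitDerivable.exists_refutation {F : CNF} (h : UnitDerivable F ∅) :
    ∃ L, IsUnitResRefutation F L := by
  obtain ⟨L, hL, -⟩ := h.exists_extension [] (fun i hi => absurd hi (Nat.not_lt_zero i))
  exact ⟨L ++ [∅], by simp, by simp, hL⟩

theorem IsResolvent.clauseSat {a : Assignment} {C D R : Clause} {x : Var}
    (h : IsResolvent C D R x) (hC : clauseSat a C) (hD : clauseSat a D) : clauseSat a R := by
  obtain ⟨-, -, rfl⟩ := h
  obtain ⟨l, hl, hla⟩ := hC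
  obtain ⟨m, hm, hma⟩ := hD
  by_cases hlx : l = (x, true)
  · refine ⟨m, Finset.mem_union_right _ (Finset.mem_erase.2 ⟨?_, hm⟩), hma⟩
    rintro rfl
    subst hlx
    simp_all [litSat]
  · exact ⟨l, Finset.mem_union_left _ (Finset.mem_erase.2 ⟨hlx, hl⟩), hla⟩

theorem IsUnitResDerivation.clauseSat {F : CNF} {L : List Clause} {a : Assignment}
    (hL : IsUnitResDerivation F L) (ha : cnfSat a F) :
    ∀ C ∈ L, clauseSat a C := by
  have key : ∀ i (hi : i < L.length), QHornProlog.clauseSat a (L.get ⟨i, hi⟩) := by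
    intro i
    induction i using Nat.strong_induction_on with
    | _ i ih =>
      intro hi
      rcases hL i hi with hF | ⟨j, k, hj, hk, x, -, hres⟩
      · exact ha _ hF
      · exact hres.clauseSat (ih j hj _) (ih k hk _)
  intro C hC
  obtain ⟨⟨i, hi⟩, rfl⟩ := List.get_of_mem hC
  exact key i hi

/-- If all variables negated in a derivable clause are derivable as units, then so is its
positive part. -/
theorem UnitDerivable.posLits {F : CNF} {C : Clause} (hC : UnitDerivable F C)
    (hneg : ∀ v, (v, false) ∈ C → UnitDerivable F {(v, true)}) :
    UnitDerivable F (posLits C) := by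
  induction hn : C.card generalizing C with
  | zero =>
    rw [Finset.card_eq_zero] at hn
    subst hn
    simpa [QHornProlog.posLits] using hC
  | succ n ih =>
    by_cases h : ∃ v, (v, false) ∈ C
    · obtain ⟨v, hv⟩ := h
      have hres : IsResolvent {(v, true)} C (C.erase (v, false)) v := by
        refine ⟨by simp, hv, ?_⟩
        ext l
        simp
      have hpos : QHornProlog.posLits (C.erase (v, false)) = QHornProlog.posLits C := by
        ext ⟨w, b⟩
        simp only [QHornProlog.posLits, Finset.mem_filter, Finset.mem_erase]
        aesop
      rw [← hpos]
      refine ih ((hneg v hv).resolve hC (by simp) hres)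
        (fun w hw => hneg w (Finset.mem_of_mem_erase hw)) ?_
      rw [Finset.card_erase_of_mem hv, hn, Nat.add_sub_cancel]
    · have hpos : QHornProlog.posLits C = C := by
        refine Finset.filter_true_of_mem ?_
        rintro ⟨w, b⟩ hw
        cases b
        · exact absurd ⟨w, hw⟩ h
        · rfl
      rwa [hpos]

/-- A Horn formula from which the empty clause is not derivable is satisfied by the assignment
making exactly the derivable unit variables true. -/
theorem IsHornFormula.satisfiable {F : CNF} (hHorn : IsHornFormula F)
    (h : ¬ UnitDerivable F ∅) : CnfSatisfiable F := by
  refine ⟨fun v => decide (UnitDerivable F {(v, true)}), fun C hC => ?_⟩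
  by_contra hsat
  have hfalse : ∀ l ∈ C, decide (UnitDerivable F {(l.1, true)}) ≠ l.2 :=
    fun l hl hla => hsat ⟨l, hl, hla⟩
  have hpos := (UnitDerivable.mem hC).posLits fun v hv => by simpa using hfalse _ hv
  rcases Finset.card_le_one_iff_subset_singleton.1 (hHorn C hC) with ⟨⟨v, b⟩, hsub⟩
  rcases Finset.subset_singleton_iff.1 hsub with h0 | h1
  · exact h (h0 ▸ hpos)
  · have hmem : (v, b) ∈ posLits C := h1 ▸ Finset.mem_singleton_self _
    obtain ⟨hvC, rfl⟩ : (v, b) ∈ C ∧ b = true := by simpa [posLits] using hmem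
    exact hfalse _ hvC (by simpa [h1] using hpos)

/-- Unit resolution is sound and complete for propositional Horn
formulas: a Horn formula is unsatisfiable iff it has a unit resolution refutation. -/
theorem statement_3 (F : CNF) (hHorn : IsHornFormula F) :
    ¬ CnfSatisfiable F ↔ ∃ L : List Clause, IsUnitResRefutation F L := by
  constructor
  · intro hunsat
    by_contra hno
    exact hunsat (hHorn.satisfiable fun h => hno h.exists_refutation)
  · rintro ⟨L, -, hlast, hL⟩ ⟨a, ha⟩
    obtain ⟨l, hl, -⟩ :=
      IsUnitResDerivation.clauseSat hL ha ∅ (List.mem_of_getLast? hlast)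
    exact absurd hl (Finset.notMem_empty l)

end QHornProlog
end

section
/- A quantified Horn formula F = Π.φ is false if and only if there exists a clause C′ ∈ F_∀ ∪ F_goal such that the QBF Π.(F_∃ ∧ C′) is false, where F_∃ is the set of clauses of φ with exactly one positive existential literal, F_∀ is the set of clauses of φ with exactly one positive universal literal, and F_goal is the set of clauses of φ with only negative literals. -/
attribute [local instance] Classical.propDecidable

namespace QHornProlog

theorem mem_prefixVars {Pf : QPrefix} {v : Var} :
    v ∈ prefixVars Pf ↔ ∃ p ∈ Pf, v ∈ p.2 := by
  induction Pf with
  | nil => simp [prefixVars]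
  | cons p Pf ih =>
    have hcons : prefixVars (p :: Pf) = p.2 ∪ prefixVars Pf := rfl
    simp [hcons, ih]

theorem IsExistential.not_isUniversal {Pf : QPrefix} {v : Var}
    (hd : Pf.Pairwise (fun p q => Disjoint p.2 q.2)) (he : IsExistential Pf v) :
    ¬ IsUniversal Pf v := by
  rintro ⟨q, hq, hq1, hvq⟩
  obtain ⟨p, hp, hp1, hvp⟩ := he
  have hne : p ≠ q := by
    rintro rfl
    simp [hp1] at hq1
  have : Std.Symm (fun p q : Bool × Finset Var => Disjoint p.2 q.2) := ⟨fun _ _ h => h.symm⟩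
  have hdisj : Disjoint p.2 q.2 := hd.forall hp hq hne
  exact Finset.disjoint_left.mp hdisj hvp hvq

theorem isExistential_or_isUniversal {Pf : QPrefix} {v : Var} (hv : v ∈ prefixVars Pf) :
    IsExistential Pf v ∨ IsUniversal Pf v := by
  obtain ⟨p, hp, hvp⟩ := mem_prefixVars.mp hv
  cases hq : p.1
  · exact Or.inr ⟨p, hp, hq, hvp⟩
  · exact Or.inl ⟨p, hp, hq, hvp⟩

/-- Truth of a QBF is antitone in the matrix. -/
theorem QEval.mono {Pf : QPrefix} {φ ψ : CNF} (hsub : ψ ⊆ φ) {a : Assignment}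
    (ha : QEval Pf φ a) : QEval Pf ψ a := by
  induction Pf generalizing a with
  | nil => exact fun C hC => ha C (hsub hC)
  | cons p Pf ih =>
    obtain ⟨_ | _, X⟩ := p
    · exact fun b => ih (ha b)
    · obtain ⟨b, hb⟩ := ha
      exact ⟨b, ih hb⟩

/-- A QBF is true if every clause has a positive literal on a variable that is not universal
and that is existential or already set to true. -/
theorem QEval.of_forall_pos {Pf : QPrefix} {φ : CNF} {a : Assignment}
    (hφ : ∀ C ∈ φ, ∃ x, (x, true) ∈ C ∧ ¬ IsUniversal Pf x ∧
      (IsExistential Pf x ∨ a x = true)) :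
    QEval Pf φ a := by
  induction Pf generalizing a with
  | nil =>
    intro C hC
    obtain ⟨x, hx, -, ⟨p, hp, -⟩ | h⟩ := hφ C hC
    · simp at hp
    · exact ⟨_, hx, h⟩
  | cons p Pf ih =>
    obtain ⟨_ | _, X⟩ := p
    · intro b
      refine ih fun C hC => ?_
      obtain ⟨x, hx, hu, h⟩ := hφ C hC
      simp only [IsUniversal, IsExistential, List.mem_cons, exists_eq_or_imp, override] at *
      refine ⟨x, hx, fun h' => hu (Or.inr h'), ?_⟩
      have hxX : x ∉ X := fun h' => hu (Or.inl ⟨trivial, h'⟩)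
      simpa [hxX] using h
    · refine ⟨fun _ => true, ih fun C hC => ?_⟩
      obtain ⟨x, hx, hu, h⟩ := hφ C hC
      simp only [IsUniversal, IsExistential, List.mem_cons, exists_eq_or_imp, override] at *
      refine ⟨x, hx, fun h' => hu (Or.inr h'), ?_⟩
      by_cases hxX : x ∈ X
      · simp [hxX]
      · simpa [hxX] using h

/-- The pointwise conjunction of a family of assignments. -/
noncomputable def meet {ι : Type*} (a : ι → Assignment) : Assignment :=
  fun v => decide (∀ i, a i v = true)

theorem meet_eq_true {ι : Type*} {a : ι → Assignment} {v : Var} :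
    meet a v = true ↔ ∀ i, a i v = true := by
  simp [meet]

theorem meet_eq_false {ι : Type*} {a : ι → Assignment} {v : Var} {i : ι}
    (h : a i v = false) : meet a v = false := by
  rw [← Bool.not_eq_true, meet_eq_true]
  intro h'
  simp [h' i] at h

theorem meet_override {ι : Type*} (a b : ι → Assignment) (X : Finset Var) :
    meet (fun i => override (a i) X (b i)) = override (meet a) X (meet b) := by
  funext v
  by_cases hv : v ∈ X <;> simp [meet, override, hv]

theorem meet_const {ι : Type*} [Nonempty ι] (b : Assignment) :
    meet (fun _ : ι => b) = b := by
  funext v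
  simp [meet]

/-- Winning strategies for a family of matrices over the same prefix combine, by pointwise
conjunction, to a winning strategy for `H`, provided that conjunctions of assignments which
agree on the set `U` of variables do so at the level of the matrix. -/
theorem QEval.meet {ι : Type*} [Nonempty ι] {U : Set Var} {G : ι → CNF} {H : CNF}
    (hmatrix : ∀ a : ι → Assignment, (∀ v ∈ U, ∀ i j, a i v = a j v) →
      (∀ i, cnfSat (a i) (G i)) → cnfSat (meet a) H)
    {Pf : QPrefix} (hU : ∀ v ∈ U, ¬ IsExistential Pf v) {a : ι → Assignment}
    (hagree : ∀ v ∈ U, ∀ i j, a i v = a j v) (ha : ∀ i, QEval Pf (G i) (a i)) :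
    QEval Pf H (QHornProlog.meet a) := by
  induction Pf generalizing a with
  | nil => exact hmatrix a hagree ha
  | cons p Pf ih =>
    have hU' : ∀ v ∈ U, ¬ IsExistential Pf v := fun v hv ⟨q, hq, h⟩ =>
      hU v hv ⟨q, List.mem_cons_of_mem _ hq, h⟩
    obtain ⟨_ | _, X⟩ := p
    · intro b
      have key := ih hU' (a := fun i => override (a i) X b) ?_ (fun i => ha i b)
      · rwa [meet_override a (fun _ => b), meet_const] at key
      · intro v hv i j
        simp only [override, hagree v hv i j]
    · choose b hb using ha
      refine ⟨QHornProlog.meet b, ?_⟩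
      rw [← meet_override]
      refine ih hU' (fun v hv i j => ?_) hb
      have hvX : v ∉ X := fun h => hU v hv ⟨_, List.mem_cons_self, rfl, h⟩
      simp only [override, hvX, if_false, hagree v hv i j]

theorem clauseSat_meet_of_neg {ι : Type*} {a : ι → Assignment} {C : Clause} {v : Var} {i : ι}
    (hv : (v, false) ∈ C) (h : a i v = false) : clauseSat (meet a) C :=
  ⟨_, hv, meet_eq_false h⟩

theorem mem_posLits {C : Clause} {v : Var} : (v, true) ∈ posLits C ↔ (v, true) ∈ C := by
  simp [posLits]

/-- The models of a clause with exactly one positive literal are closed under conjunction. -/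
theorem clauseSat_meet_of_forall {ι : Type*} [Nonempty ι] {a : ι → Assignment} {C : Clause}
    {x : Var} (hC : posLits C = {(x, true)}) (h : ∀ i, clauseSat (a i) C) :
    clauseSat (meet a) C := by
  by_cases hneg : ∃ i v, (v, false) ∈ C ∧ a i v = false
  · obtain ⟨i, v, hv, hi⟩ := hneg
    exact clauseSat_meet_of_neg hv hi
  · push Not at hneg
    refine ⟨(x, true), mem_posLits.mp (by simp [hC]), meet_eq_true.mpr fun i => ?_⟩
    obtain ⟨⟨v, _ | _⟩, hv, hi⟩ := h i
    · exact absurd hi (hneg i v hv)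
    · have hvx := mem_posLits.mpr hv
      rw [hC, Finset.mem_singleton, Prod.mk.injEq] at hvx
      rw [← hvx.1]
      exact hi

/-- If all assignments of a family agree on the positive literals of a clause and one of them
satisfies it, then so does their conjunction. -/
theorem clauseSat_meet_of_agree {ι : Type*} {a : ι → Assignment} {C : Clause} {i : ι}
    (hagree : ∀ v, (v, true) ∈ C → ∀ j, a j v = a i v) (h : clauseSat (a i) C) :
    clauseSat (meet a) C := by
  obtain ⟨⟨v, _ | _⟩, hv, hi⟩ := h
  · exact clauseSat_meet_of_neg hv hi
  · exact ⟨_, hv, meet_eq_true.mpr fun j => (hagree v hv j).trans hi⟩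

theorem IsQHorn.mem_Fexist_or {Pf : QPrefix} {φ : CNF} (h : IsQHorn Pf φ) {C : Clause}
    (hC : C ∈ φ) : C ∈ Fexist Pf φ ∨ C ∈ Fforall Pf φ ∪ Fgoal φ := by
  rcases Nat.le_one_iff_eq_zero_or_eq_one.mp (h.2 C hC) with h0 | h1
  · refine Or.inr (Finset.mem_union_right _ (Finset.mem_filter.mpr ⟨hC, ?_⟩))
    rintro ⟨v, _ | _⟩ hv
    · rfl
    · rw [Finset.card_eq_zero] at h0
      simpa [h0] using mem_posLits.mpr hv
  · obtain ⟨⟨x, s⟩, hx⟩ := Finset.card_eq_one.mp h1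
    have hmem : (x, s) ∈ posLits C := by simp [hx]
    obtain ⟨hxC, hs⟩ := Finset.mem_filter.mp hmem
    obtain rfl : s = true := hs
    have hvar : x ∈ prefixVars Pf := by
      refine h.1.2 ((Finset.le_sup (f := clauseVars) hC : clauseVars C ⊆ cnfVars φ) ?_)
      exact Finset.mem_image.mpr ⟨_, hxC, rfl⟩
    rcases isExistential_or_isUniversal hvar with he | hu
    · exact Or.inl (Finset.mem_filter.mpr ⟨hC, x, hx, he⟩)
    · exact Or.inr (Finset.mem_union_left _ (Finset.mem_filter.mpr ⟨hC, x, hx, hu⟩))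

theorem isUniversal_of_pos_mem {Pf : QPrefix} {φ : CNF} {C : Clause}
    (hC : C ∈ Fforall Pf φ ∪ Fgoal φ) {v : Var} (hv : (v, true) ∈ C) : IsUniversal Pf v := by
  rcases Finset.mem_union.mp hC with hC | hC
  · obtain ⟨-, x, hx, hu⟩ := Finset.mem_filter.mp hC
    have hvx := mem_posLits.mpr hv
    rw [hx, Finset.mem_singleton, Prod.mk.injEq] at hvx
    rwa [hvx.1]
  · simpa using (Finset.mem_filter.mp hC).2 _ hv

/-- A quantified Horn formula `Pf.φ` is false iff there is a clause
`C' ∈ F_∀ ∪ F_goal` such that `Pf.(F_∃ ∧ C')` is false. -/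
theorem statement_5 (Pf : QPrefix) (φ : CNF) (h : IsQHorn Pf φ) :
    ¬ QTrue Pf φ ↔
      ∃ C' ∈ Fforall Pf φ ∪ Fgoal φ, ¬ QTrue Pf (insert C' (Fexist Pf φ)) := by
  have hd := h.1.1
  constructor
  · intro hfalse
    by_contra! hall
    apply hfalse
    rcases (Fforall Pf φ ∪ Fgoal φ).eq_empty_or_nonempty with hempty | hne
    · refine QEval.of_forall_pos fun C hC => ?_
      have hCe : C ∈ Fexist Pf φ := by
        simpa [hempty] using h.mem_Fexist_or hC
      obtain ⟨-, x, hx, he⟩ := Finset.mem_filter.mp hCe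
      exact ⟨x, mem_posLits.mp (by simp [hx]), he.not_isUniversal hd, Or.inl he⟩
    · have : Nonempty {C // C ∈ Fforall Pf φ ∪ Fgoal φ} := hne.to_subtype
      have key := QEval.meet (ι := {C // C ∈ Fforall Pf φ ∪ Fgoal φ})
        (U := {v | IsUniversal Pf v}) (G := fun C => insert C.1 (Fexist Pf φ)) (H := φ)
        (Pf := Pf) (a := fun _ _ => false) ?_ (fun v hv he => he.not_isUniversal hd hv)
        (fun _ _ _ _ => rfl) (fun C => hall C.1 C.2)
      · rwa [meet_const] at key
      · intro a hagree hsat C hC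
        rcases h.mem_Fexist_or hC with hCe | hC'
        · obtain ⟨-, x, hx, -⟩ := Finset.mem_filter.mp hCe
          exact clauseSat_meet_of_forall hx fun i => hsat i C (Finset.mem_insert_of_mem hCe)
        · exact clauseSat_meet_of_agree (i := ⟨C, hC'⟩)
            (fun v hv j => hagree v (isUniversal_of_pos_mem hC' hv) j _)
            (hsat ⟨C, hC'⟩ C (Finset.mem_insert_self _ _))
  · rintro ⟨C, hC, hfalse⟩ htrue
    refine hfalse (htrue.mono (Finset.insert_subset ?_ (Finset.filter_subset _ _)))
    rcases Finset.mem_union.mp hC with hC | hC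
    · exact (Finset.mem_filter.mp hC).1
    · exact (Finset.mem_filter.mp hC).1

end QHornProlog
end

section
/- Let F = Π.φ be a false quantified Horn formula and let C′ be a clause of φ containing only negative literals such that the QBF Π.(F_∃ ∧ C′) is false, where F_∃ is the set of clauses of φ with exactly one positive existential literal. Then for every existential variable q with ¬q ∈ C′, there exists a clause C ∈ F_∃ whose head (its unique positive literal) is q. -/
attribute [local instance] Classical.propDecidable

namespace QHornProlog

/-- If every assignment giving the existential variables the constant values `s` satisfies
the matrix, then playing `s` is a winning existential strategy. -/
theorem qEval_of_constant_strategy (s : Assignment) (φ : CNF) (Pf : QPrefix)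
    (hdisj : Pf.Pairwise (fun p q => Disjoint p.2 q.2)) (a : Assignment)
    (hsat : ∀ a' : Assignment, (∀ v, IsExistential Pf v → a' v = s v) →
      (∀ v, v ∉ prefixVars Pf → a' v = a v) → cnfSat a' φ) :
    QEval Pf φ a := by
  induction Pf generalizing a with
  | nil =>
    exact hsat a (fun v ⟨p, hp, _⟩ => absurd hp List.not_mem_nil) (fun _ _ => rfl)
  | cons p Pf ih =>
    obtain ⟨Q, X⟩ := p
    obtain ⟨hX, hPf⟩ := List.pairwise_cons.1 hdisj
    have hnot : ∀ v ∈ X, v ∉ prefixVars Pf := by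
      intro v hv hmem
      obtain ⟨p, hp, hvp⟩ := mem_prefixVars.1 hmem
      exact Finset.disjoint_left.1 (hX p hp) hv hvp
    have hstep : ∀ b : Assignment, (Q = true → b = s) → QEval Pf φ (override a X b) := by
      intro b hb
      refine ih hPf _ fun a' hex hout => hsat a' ?_ ?_
      · rintro v ⟨p, hp, hpt, hvp⟩
        rcases List.mem_cons.1 hp with rfl | hp
        · rw [hout v (hnot v hvp), override, if_pos hvp, hb hpt]
        · exact hex v ⟨p, hp, hpt, hvp⟩
      · intro v hv
        have hv' : v ∉ X ∪ prefixVars Pf := hv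
        rw [Finset.mem_union, not_or] at hv'
        rw [hout v hv'.2, override, if_neg hv'.1]
    cases Q with
    | true => exact ⟨s, hstep s fun _ => rfl⟩
    | false => exact fun b => hstep b fun hb => absurd hb Bool.false_ne_true

/-- If `Pf.φ` is a false quantified Horn formula and `C' ∈ φ` is a
negative clause with `Pf.(F_∃ ∧ C')` false, then every existential variable `q`
with `¬q ∈ C'` is the head of some clause of `F_∃`. -/
theorem statement_6 (Pf : QPrefix) (φ : CNF) (h : IsQHorn Pf φ)
    (hfalse : ¬ QTrue Pf φ)
    (C' : Clause) (hC' : C' ∈ φ) (hneg : IsNegativeClause C')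
    (hsub : ¬ QTrue Pf (insert C' (Fexist Pf φ)))
    (q : Var) (hq : IsExistential Pf q) (hqC : (q, false) ∈ C') :
    ∃ C ∈ Fexist Pf φ, posLits C = {(q, true)} := by
  by_contra hno
  refine hsub (qEval_of_constant_strategy (fun v => decide (v ≠ q)) _ Pf h.1.1 _ ?_)
  intro a hex _ C hC
  rcases Finset.mem_insert.1 hC with rfl | hC
  · exact ⟨(q, false), hqC, by simp [litSat, hex q hq]⟩
  · obtain ⟨_, x, hx, hxe⟩ := Finset.mem_filter.1 hC
    have hxq : x ≠ q := by
      rintro rfl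
      exact hno ⟨C, hC, hx⟩
    have hxC : (x, true) ∈ posLits C := by simp [hx]
    exact ⟨(x, true), (Finset.mem_filter.1 hxC).1, by simp [litSat, hex x hxe, hxq]⟩

end QHornProlog
end

section
/- Let F = Π.φ be a false quantified Horn formula and let C′ be a clause of φ with exactly one positive universal literal such that the QBF Π.(F_∃ ∧ C′) is false, where F_∃ is the set of clauses of φ with exactly one positive existential literal. Then for every existential variable q with ¬q ∈ C′, there exists a clause C ∈ F_∃ whose head (its unique positive literal) is q. -/
attribute [local instance] Classical.propDecidable

namespace QHornProlog

/-- If every assignment agreeing with `s` on `S` and on the existential variables satisfies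
the matrix, then playing `s` on the existential variables witnesses the truth of the QBF
under any ambient assignment agreeing with `s` on `S`. -/
lemma qEval_of_forall_agree (s : Assignment) (ψ : CNF) (Pf : QPrefix) (S : Set Var)
    (a : Assignment) (hdisj : Pf.Pairwise (fun p q => Disjoint p.2 q.2))
    (hS : ∀ v ∈ S, ¬ IsUniversal Pf v) (ha : ∀ v ∈ S, a v = s v)
    (hsat : ∀ a' : Assignment, (∀ v, v ∈ S ∨ IsExistential Pf v → a' v = s v) → cnfSat a' ψ) :
    QEval Pf ψ a := by
  induction Pf generalizing S a with
  | nil =>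
    refine hsat a fun v hv => hv.elim (ha v) ?_
    rintro ⟨p, hp, -⟩
    simp at hp
  | cons p Pf ih =>
    obtain ⟨hp, hdisj_tail⟩ := List.pairwise_cons.1 hdisj
    have hS_tail : ∀ v ∈ S, ¬ IsUniversal Pf v := fun v hv ⟨r, hr, h⟩ =>
      hS v hv ⟨r, List.mem_cons_of_mem _ hr, h⟩
    obtain ⟨_ | _, X⟩ := p
    · intro b
      refine ih S _ hdisj_tail hS_tail (fun v hv => ?_) fun a' ha' => hsat a' fun v hv => ha' v ?_
      · have hvX : v ∉ X := fun hvX => hS v hv ⟨(false, X), List.mem_cons_self, rfl, hvX⟩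
        simp [override, hvX, ha v hv]
      · refine hv.imp_right ?_
        rintro ⟨r, hr, hr1, hr2⟩
        rcases List.mem_cons.1 hr with rfl | hr
        · simp at hr1
        · exact ⟨r, hr, hr1, hr2⟩
    · refine ⟨s, ih (S ∪ X) _ hdisj_tail ?_ ?_ fun a' ha' => hsat a' fun v hv => ha' v ?_⟩
      · rintro v (hv | hv)
        · exact hS_tail v hv
        · rintro ⟨r, hr, -, hvr⟩
          exact Finset.disjoint_left.1 (hp r hr) hv hvr
      · intro v hv
        by_cases hvX : v ∈ X
        · simp [override, hvX]
        · simp [override, hvX, ha v (hv.resolve_right hvX)]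
      · rcases hv with hv | ⟨r, hr, hr1, hr2⟩
        · exact Or.inl (Or.inl hv)
        · rcases List.mem_cons.1 hr with rfl | hr
          · exact Or.inl (Or.inr hr2)
          · exact Or.inr ⟨r, hr, hr1, hr2⟩

/-- If `Pf.φ` is a false quantified Horn formula and `C' ∈ F_∀` (a
clause of `φ` with exactly one positive, universal, literal) with `Pf.(F_∃ ∧ C')`
false, then every existential variable `q` with `¬q ∈ C'` is the head of some
clause of `F_∃`. -/
theorem statement_7 (Pf : QPrefix) (φ : CNF) (h : IsQHorn Pf φ)
    (hfalse : ¬ QTrue Pf φ)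
    (C' : Clause) (hC' : C' ∈ Fforall Pf φ)
    (hsub : ¬ QTrue Pf (insert C' (Fexist Pf φ)))
    (q : Var) (hq : IsExistential Pf q) (hqC : (q, false) ∈ C') :
    ∃ C ∈ Fexist Pf φ, posLits C = {(q, true)} := by
  by_contra! hno
  refine hsub (qEval_of_forall_agree (fun v => decide (v ≠ q)) _ Pf ∅ _ h.1.1
    (by simp) (by simp) fun a ha C hC => ?_)
  rcases Finset.mem_insert.1 hC with rfl | hC
  · exact ⟨_, hqC, by simpa [litSat] using ha q (Or.inr hq)⟩
  · obtain ⟨x, hx, hxe⟩ := (Finset.mem_filter.1 hC).2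
    have hxC : (x, true) ∈ posLits C := hx ▸ Finset.mem_singleton_self _
    have hxq : x ≠ q := fun hxq => hno C hC (hxq ▸ hx)
    exact ⟨_, (Finset.mem_filter.1 hxC).1, by simpa [litSat, hxq] using ha x (Or.inr hxe)⟩

end QHornProlog
end

section
/- Let Π.φ and Π.φ′ be two QBFs with the same prefix Π = Q₁X₁…QₙXₙ, and let 0 ≤ i ≤ n. If the abstractions Π_i.φ and Π_i.φ′ are logically equivalent, then Π.φ and Π.φ′ are logically equivalent. -/
attribute [local instance] Classical.propDecidable

namespace QHornProlog

theorem prefixVars_append (Pf Pf' : QPrefix) :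
    prefixVars (Pf ++ Pf') = prefixVars Pf ∪ prefixVars Pf' := by
  ext v
  simp only [mem_prefixVars, Finset.mem_union, List.mem_append, or_and_right, exists_or]

theorem varsUpTo_mono (Pf : QPrefix) {i j : ℕ} (hij : i ≤ j) :
    varsUpTo Pf i ⊆ varsUpTo Pf j := by
  intro v hv
  obtain ⟨p, hp, hvp⟩ := mem_prefixVars.1 hv
  exact mem_prefixVars.2 ⟨p, (List.take_sublist_take_left hij).subset hp, hvp⟩

theorem varsUpTo_abstraction_succ (Pf : QPrefix) (i j : ℕ) :
    varsUpTo (abstraction Pf i) (j + 1) = varsUpTo Pf (i + j) := by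
  have hcons : varsUpTo (abstraction Pf i) (j + 1) =
      varsUpTo Pf i ∪ prefixVars ((Pf.drop i).take j) := rfl
  rw [hcons, varsUpTo, varsUpTo, List.take_add, prefixVars_append]

/-- The Skolem family that is constantly `a` on `X` and agrees with `σ` elsewhere. -/
noncomputable def fixOn (X : Finset Var) (a : Assignment) (σ : SkolemFamily) : SkolemFamily :=
  fun v b => if v ∈ X then a v else σ v b

theorem DependsOnlyOuter.fixOn_abstraction {Pf : QPrefix} {σ : SkolemFamily}
    (hσ : DependsOnlyOuter Pf σ) (i : ℕ) (a : Assignment) :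
    DependsOnlyOuter (abstraction Pf i) (fixOn (varsUpTo Pf i) a σ) := by
  intro j hj hex v hv b c hbc
  by_cases hvi : v ∈ varsUpTo Pf i
  · simp [fixOn, hvi]
  · cases j with
    | zero => exact absurd hv hvi
    | succ j =>
      rw [varsUpTo_abstraction_succ] at hbc
      have hlt : i + j < Pf.length := by
        simp only [abstraction, List.length_cons, List.length_drop] at hj
        omega
      have hget : (abstraction Pf i).get ⟨j + 1, hj⟩ = Pf.get ⟨i + j, hlt⟩ := by
        simp [abstraction]
      rw [hget] at hex hv
      simpa [fixOn, hvi] using hσ (i + j) hlt hex v hv b c hbc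

theorem ConsistentWith.fixOn_abstraction {Pf : QPrefix} {σ : SkolemFamily} {a : Assignment}
    (ha : ConsistentWith Pf σ a) (i : ℕ) :
    ConsistentWith (abstraction Pf i) (fixOn (varsUpTo Pf i) a σ) a := by
  rintro v ⟨p, hp, hex, hv⟩
  by_cases hvi : v ∈ varsUpTo Pf i
  · simp [fixOn, hvi]
  · rcases List.mem_cons.1 hp with rfl | hp
    · exact absurd hv hvi
    · simpa [fixOn, hvi] using ha v ⟨p, List.mem_of_mem_drop hp, hex, hv⟩

theorem ConsistentWith.of_fixOn_abstraction {Pf : QPrefix} {σ : SkolemFamily}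
    {a b : Assignment} {i : ℕ} (hdisj : Pf.Pairwise (fun p q => Disjoint p.2 q.2))
    (hσ : DependsOnlyOuter Pf σ) (ha : ConsistentWith Pf σ a)
    (hb : ConsistentWith (abstraction Pf i) (fixOn (varsUpTo Pf i) a σ) b) :
    ConsistentWith Pf σ b := by
  have hab : ∀ v ∈ varsUpTo Pf i, a v = b v := by
    intro v hv
    have := hb v ⟨(true, varsUpTo Pf i), List.mem_cons_self, rfl, hv⟩
    simpa [fixOn, hv] using this.symm
  rintro v ⟨p, hp, hex, hv⟩
  rw [← List.take_append_drop i Pf] at hp hdisj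
  rcases List.mem_append.1 hp with hp | hp
  · obtain ⟨j, hj, rfl⟩ := List.getElem_of_mem hp
    have hvi : v ∈ varsUpTo Pf i := mem_prefixVars.2 ⟨_, hp, hv⟩
    have hj' : j < i ∧ j < Pf.length := by simpa using hj
    have hget : (Pf.take i)[j] = Pf.get ⟨j, hj'.2⟩ := by simp
    rw [← hab v hvi, ha v ⟨_, List.mem_of_mem_take hp, hex, hv⟩]
    rw [hget] at hex hv
    exact hσ j hj'.2 hex v hv a b fun w hw => hab w (varsUpTo_mono Pf hj'.1.le hw)
  · have hvi : v ∉ varsUpTo Pf i := by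
      intro hvi
      obtain ⟨q, hq, hvq⟩ := mem_prefixVars.1 hvi
      exact Finset.disjoint_left.1 ((List.pairwise_append.1 hdisj).2.2 q hq p hp) hvq hv
    simpa [fixOn, hvi] using hb v ⟨p, List.mem_cons_of_mem _ hp, hex, hv⟩

theorem IsModel.of_abstraction_logEquiv {Pf : QPrefix} {φ φ' : CNF} {i : ℕ}
    {σ : SkolemFamily} (hdisj : Pf.Pairwise (fun p q => Disjoint p.2 q.2))
    (h : LogEquiv (abstraction Pf i) φ φ') (hσ : IsModel Pf φ σ) : IsModel Pf φ' σ :=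
  ⟨hσ.1, fun a ha =>
    ((h (fixOn (varsUpTo Pf i) a σ)).1 ⟨hσ.1.fixOn_abstraction i a, fun _ hb =>
      hσ.2 _ (ha.of_fixOn_abstraction hdisj hσ.1 hb)⟩).2 a (ha.fixOn_abstraction i)⟩

/-- If the abstractions `Pf_i.φ` and `Pf_i.φ'` are logically
equivalent, then `Pf.φ` and `Pf.φ'` are logically equivalent. -/
theorem statement_9 (Pf : QPrefix) (φ φ' : CNF)
    (hc : ClosedQBF Pf φ) (hc' : ClosedQBF Pf φ')
    (i : ℕ) (hi : i ≤ Pf.length)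
    (h : LogEquiv (abstraction Pf i) φ φ') :
    LogEquiv Pf φ φ' := by
  exact fun σ => ⟨fun hσ => hσ.of_abstraction_logEquiv hc.1 h,
    fun hσ => hσ.of_abstraction_logEquiv hc.1 fun τ => (h τ).symm⟩

end QHornProlog
end

section
/- Let Π.φ be a quantified Horn formula with prefix Π = Q₁X₁…QₙXₙ where Q₁ = ∃, and let C be a Horn clause all of whose variables lie in the first block X₁. If the quantified Horn formula Π.(φ ∧ C̄) has an SLD-Q-resolution refutation, where C̄ denotes the conjunction of unit clauses {¬ℓ} for each literal ℓ of C, then Π.φ and Π.(φ ∧ C) are logically equivalent. -/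
attribute [local instance] Classical.propDecidable

namespace QHornProlog

theorem exists_get_eq_of_mem {Pf : QPrefix} {p : Bool × Finset Var} (hp : p ∈ Pf) :
    ∃ (i : ℕ) (h : i < Pf.length), Pf.get ⟨i, h⟩ = p := by
  obtain ⟨i, hi⟩ := List.get_of_mem hp
  exact ⟨i, i.2, hi⟩

theorem hasLevel_unique {Pf : QPrefix} (hd : Pf.Pairwise (fun p q => Disjoint p.2 q.2))
    {v : Var} {i j : ℕ} (hi : hasLevel Pf v i) (hj : hasLevel Pf v j) : i = j := by
  obtain ⟨hi, hvi⟩ := hi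
  obtain ⟨hj, hvj⟩ := hj
  rw [List.pairwise_iff_get] at hd
  rcases lt_trichotomy i j with h | h | h
  · exact absurd hvj (Finset.disjoint_left.mp (hd ⟨i, hi⟩ ⟨j, hj⟩ h) hvi)
  · exact h
  · exact absurd hvi (Finset.disjoint_left.mp (hd ⟨j, hj⟩ ⟨i, hi⟩ h) hvj)

theorem exists_hasLevel_of_mem_varsUpTo {Pf : QPrefix} {v : Var} {i : ℕ}
    (h : v ∈ varsUpTo Pf i) : ∃ k < i, hasLevel Pf v k := by
  obtain ⟨p, hp, hv⟩ := mem_prefixVars.mp h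
  obtain ⟨k, hk, rfl⟩ := exists_get_eq_of_mem hp
  rw [List.length_take] at hk
  refine ⟨k, by omega, by omega, ?_⟩
  simpa using hv

/-- Consistency can be restored block by block after setting a variable `u` of a universal
block `j` to true, without changing other universal variables or variables left of `u`. -/
theorem exists_partially_consistent_flip {Pf : QPrefix} {σ : SkolemFamily}
    (hd : Pf.Pairwise (fun p q => Disjoint p.2 q.2)) (hσ : DependsOnlyOuter Pf σ)
    {a : Assignment} (ha : ConsistentWith Pf σ a) {u : Var} {j : ℕ} (hj : j < Pf.length)
    (hju : (Pf.get ⟨j, hj⟩).1 = false) (hu : u ∈ (Pf.get ⟨j, hj⟩).2) (n : ℕ) :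
    ∃ a' : Assignment, a' u = true ∧
      (∀ v, v ≠ u → (¬ IsExistential Pf v ∨ ∃ k < j, hasLevel Pf v k) → a' v = a v) ∧
      ∀ i (hi : i < Pf.length), i < n → (Pf.get ⟨i, hi⟩).1 = true →
        ∀ v ∈ (Pf.get ⟨i, hi⟩).2, a' v = σ v a' := by
  induction n with
  | zero =>
    refine ⟨Function.update a u true, by simp, fun v hv _ => by simp [hv], ?_⟩
    intro i _ h
    omega
  | succ n ih =>
    obtain ⟨a', h1, h2, h3⟩ := ih
    by_cases hn : ∃ h : n < Pf.length, (Pf.get ⟨n, h⟩).1 = true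
    swap
    · refine ⟨a', h1, h2, fun i hi hin hex v hv => ?_⟩
      rcases Nat.lt_succ_iff_lt_or_eq.mp hin with h | rfl
      · exact h3 i hi h hex v hv
      · exact absurd ⟨hi, hex⟩ hn
    obtain ⟨hn, hnex⟩ := hn
    have huj : hasLevel Pf u j := ⟨hj, hu⟩
    rcases lt_trichotomy n j with hnj | rfl | hnj
    · refine ⟨a', h1, h2, fun i hi hin hex v hv => ?_⟩
      rcases Nat.lt_succ_iff_lt_or_eq.mp hin with h | rfl
      · exact h3 i hi h hex v hv
      have hne : ∀ w k, k < j → hasLevel Pf w k → w ≠ u := by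
        rintro w k hk hw rfl
        exact hk.ne (hasLevel_unique hd hw huj)
      have hav : a' v = a v := h2 v (hne v i hnj ⟨hi, hv⟩) (Or.inr ⟨i, hnj, hi, hv⟩)
      rw [hav, ha v ⟨_, List.get_mem _ _, hex, hv⟩]
      refine hσ i hi hex v hv _ _ fun w hw => ?_
      obtain ⟨k, hk, hwk⟩ := exists_hasLevel_of_mem_varsUpTo hw
      exact (h2 w (hne w k (hk.trans hnj) hwk) (Or.inr ⟨k, hk.trans hnj, hwk⟩)).symm
    · rw [hju] at hnex
      exact absurd hnex (by simp)
    · have hout : ∀ w k, k ≠ n → hasLevel Pf w k → w ∉ (Pf.get ⟨n, hn⟩).2 :=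
        fun w k hk hw hmem => hk (hasLevel_unique hd hw ⟨hn, hmem⟩)
      have hdep : ∀ i (hi : i < Pf.length), i ≤ n → (Pf.get ⟨i, hi⟩).1 = true →
          ∀ v ∈ (Pf.get ⟨i, hi⟩).2, σ v a' =
            σ v (fun w => if w ∈ (Pf.get ⟨n, hn⟩).2 then σ w a' else a' w) := by
        intro i hi hin hex v hv
        refine hσ i hi hex v hv _ _ fun w hw => ?_
        obtain ⟨k, hk, hwk⟩ := exists_hasLevel_of_mem_varsUpTo hw
        exact (if_neg (hout w k (by omega) hwk)).symm
      refine ⟨fun w => if w ∈ (Pf.get ⟨n, hn⟩).2 then σ w a' else a' w, ?_, ?_, ?_⟩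
      · exact (if_neg (hout u j (by omega) huj)).trans h1
      · intro v hv hor
        refine (if_neg ?_).trans (h2 v hv hor)
        rcases hor with h | ⟨k, hk, hvk⟩
        · exact fun hmem => h ⟨_, List.get_mem _ _, hnex, hmem⟩
        · exact hout v k (by omega) hvk
      · intro i hi hin hex v hv
        rw [← hdep i hi (by omega) hex v hv]
        rcases Nat.lt_succ_iff_lt_or_eq.mp hin with h | rfl
        · exact (if_neg (hout v i (by omega) ⟨hi, hv⟩)).trans (h3 i hi h hex v hv)
        · exact if_pos hv

/-- Every step of SLD-Q-resolution preserves negativity and is sound for consistent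
assignments. -/
theorem SLDQStep.sound {Pf : QPrefix} {ψ : CNF} {σ : SkolemFamily}
    (hd : Pf.Pairwise (fun p q => Disjoint p.2 q.2)) (hσ : IsModel Pf ψ σ)
    {N N' : Clause} (hstep : SLDQStep Pf ψ N N') (hneg : IsNegativeClause N)
    (hN : ∀ a, ConsistentWith Pf σ a → clauseSat a N) :
    IsNegativeClause N' ∧ ∀ a, ConsistentWith Pf σ a → clauseSat a N' := by
  rcases hstep with ⟨D, hD, x, hpos, -, -, rfl⟩ | ⟨l, hl, ⟨p, hp, hpu, hlp⟩, hblock, rfl⟩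
  · constructor
    · intro k hk
      rcases Finset.mem_union.mp hk with hk | hk
      · exact hneg k (Finset.mem_of_mem_erase hk)
      · obtain ⟨hne, hkD⟩ := Finset.mem_erase.mp hk
        by_contra h
        have hmem : k ∈ posLits D := Finset.mem_filter.mpr ⟨hkD, by simpa using h⟩
        rw [hpos, Finset.mem_singleton] at hmem
        exact hne hmem
    · intro a ha
      cases hx : a x with
      | true =>
        obtain ⟨k, hk, hs⟩ := hN a ha
        refine ⟨k, Finset.mem_union_left _ (Finset.mem_erase.mpr ⟨?_, hk⟩), hs⟩
        rintro rfl
        simp [litSat, hx] at hs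
      | false =>
        obtain ⟨k, hk, hs⟩ := hσ.2 a ha D hD
        refine ⟨k, Finset.mem_union_right _ (Finset.mem_erase.mpr ⟨?_, hk⟩), hs⟩
        rintro rfl
        simp [litSat, hx] at hs
  · refine ⟨fun k hk => hneg k (Finset.mem_of_mem_erase hk), fun a ha => ?_⟩
    obtain ⟨j, hj, rfl⟩ := exists_get_eq_of_mem hp
    obtain ⟨a', h1, h2, h3⟩ :=
      exists_partially_consistent_flip hd hσ.1 ha hj hpu hlp Pf.length
    have hcons : ConsistentWith Pf σ a' := by
      rintro v ⟨q, hq, hqe, hvq⟩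
      obtain ⟨i, hi, rfl⟩ := exists_get_eq_of_mem hq
      exact h3 i hi hi hqe v hvq
    obtain ⟨k, hk, hs⟩ := hN a' hcons
    have hkl : k.1 ≠ l.1 := by
      intro h
      rw [litSat, h, h1, hneg k hk] at hs
      exact absurd hs (by simp)
    refine ⟨k, Finset.mem_erase.mpr ⟨fun h => hkl (by rw [h]), hk⟩, ?_⟩
    have hak : a' k.1 = a k.1 := by
      refine h2 k.1 hkl ?_
      by_cases hex : IsExistential Pf k.1
      · right
        obtain ⟨q, hq, -, hkq⟩ := id hex
        obtain ⟨i, hi, rfl⟩ := exists_get_eq_of_mem hq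
        refine ⟨i, ?_, hi, hkq⟩
        by_contra hij
        exact hblock k hk hex ⟨j, i, not_lt.mp hij, ⟨hj, hlp⟩, ⟨hi, hkq⟩⟩
      · exact Or.inl hex
    rwa [litSat, ← hak]

/-- A formula with an SLD-Q-resolution refutation has no model that admits a consistent
assignment. -/
theorem IsSLDQRefutation.not_consistentWith {Pf : QPrefix} {ψ : CNF} {σ : SkolemFamily}
    {L : List Clause} (hL : IsSLDQRefutation Pf ψ L)
    (hd : Pf.Pairwise (fun p q => Disjoint p.2 q.2)) (hσ : IsModel Pf ψ σ)
    (a : Assignment) : ¬ ConsistentWith Pf σ a := by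
  intro ha
  obtain ⟨hne, hhead, hneg, hlast, hsteps⟩ := hL
  have key : ∀ i (hi : i < L.length), IsNegativeClause (L.get ⟨i, hi⟩) ∧
      ∀ a, ConsistentWith Pf σ a → clauseSat a (L.get ⟨i, hi⟩) := by
    intro i
    induction i with
    | zero =>
      intro hi
      have h : L.get ⟨0, hi⟩ = L.head hne := by simp [List.head_eq_getElem]
      rw [h]
      exact ⟨hneg, fun a ha => hσ.2 a ha _ hhead⟩
    | succ i ih =>
      intro hi
      obtain ⟨h1, h2⟩ := ih (Nat.lt_of_succ_lt hi)
      exact (hsteps i hi).sound hd hσ h1 h2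
  have hlen : L.length - 1 < L.length := Nat.sub_lt (List.length_pos_of_ne_nil hne) one_pos
  have h : L.get ⟨L.length - 1, hlen⟩ = ∅ := by
    rw [← hlast, List.getLast_eq_getElem]
    rfl
  obtain ⟨k, hk, -⟩ := (key _ hlen).2 a ha
  rw [h] at hk
  exact absurd hk (by simp)

theorem ConsistentWith.eq_on_first_block {X : Finset Var} {Pf' : QPrefix} {σ : SkolemFamily}
    (hσ : DependsOnlyOuter ((true, X) :: Pf') σ) {a b : Assignment}
    (ha : ConsistentWith ((true, X) :: Pf') σ a) (hb : ConsistentWith ((true, X) :: Pf') σ b)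
    {v : Var} (hv : v ∈ X) : a v = b v := by
  have hex : IsExistential ((true, X) :: Pf') v := ⟨(true, X), by simp, rfl, hv⟩
  rw [ha v hex, hb v hex]
  exact hσ 0 (by simp) rfl v hv a b fun w hw => by simp [varsUpTo, prefixVars] at hw

/-- Let `Pf.φ` be a quantified Horn formula whose first block is
existential, and `C` a Horn clause with all variables in the first block. If
`Pf.(φ ∧ C̄)` has an SLD-Q-resolution refutation, then `Pf.φ` and `Pf.(φ ∧ C)` are
logically equivalent. -/
theorem statement_10 (X : Finset Var) (Pf' : QPrefix) (φ : CNF)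
    (hQH : IsQHorn ((true, X) :: Pf') φ)
    (C : Clause) (hHorn : IsHornClause C) (hvars : clauseVars C ⊆ X)
    (href : ∃ L : List Clause,
      IsSLDQRefutation ((true, X) :: Pf') (φ ∪ negUnits C) L) :
    LogEquiv ((true, X) :: Pf') φ (insert C φ) := by
  intro σ
  refine ⟨fun hσ => ⟨hσ.1, fun a ha D hD => ?_⟩,
    fun hσ => ⟨hσ.1, fun a ha D hD => hσ.2 a ha D (Finset.mem_insert_of_mem hD)⟩⟩
  rcases Finset.mem_insert.mp hD with rfl | hD
  swap
  · exact hσ.2 a ha D hD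
  by_contra hfalse
  obtain ⟨L, hL⟩ := href
  refine hL.not_consistentWith hQH.1.1 ⟨hσ.1, fun b hb E hE => ?_⟩ a ha
  rcases Finset.mem_union.mp hE with hE | hE
  · exact hσ.2 b hb E hE
  obtain ⟨l, hl, rfl⟩ := Finset.mem_image.mp hE
  refine ⟨negLit l, by simp, ?_⟩
  have hab : a l.1 = b l.1 :=
    ha.eq_on_first_block hσ.1 hb (hvars (Finset.mem_image_of_mem _ hl))
  have hal : a l.1 ≠ l.2 := fun h => hfalse ⟨l, hl, h⟩
  rw [hab] at hal
  exact Bool.eq_not.mpr hal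

end QHornProlog
end
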